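/- Let a be an internal node of T, let u be any node in the right subtree R_a, and let v be any node in the left subtree L_a. Then A_d(v) + s_u > B. (Interpretation: a non-adaptive policy on the line cannot collect reward from v if any such vertex u in its blocking set instantiates to a positive size.) -/

import Mathlib

namespace StocOrient

/-- State along a root-to-node walk in the tree `T`:
current node's size `sz`, residual budget `bu`, distance traveled `dist`
(i.e. `A_d`), and size instantiated `inst` (i.e. `A_s`). -/
structure St where
  sz : ℚ
  bu : ℚ
  dist : ℚ
  inst : ℚ

/-- One step from a node at level `lvl` to one of its children
(`true` = right child, `false` = left child); the child is at level `lvl - 1`. -/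
def step (lvl : ℕ) (x : St) (dir : Bool) : St :=
  if dir then
    { sz := x.sz * (2 : ℚ) ^ ((2 : ℤ) ^ (lvl - 1)),
      bu := x.bu - x.sz,
      dist := x.dist,
      inst := x.inst + x.sz }
  else
    { sz := x.sz * (2 : ℚ) ^ (-((2 : ℤ) ^ (lvl - 1))),
      bu := x.sz,
      dist := x.dist + (x.bu - x.sz),
      inst := x.inst }

def walkAux : ℕ → St → List Bool → St
  | _, x, [] => x
  | lvl, x, d :: rest => walkAux (lvl - 1) (step lvl x d) rest

/-- The budget `B = 2^(2^(L+1))`. -/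
def Bq (L : ℕ) : ℚ := 2 ^ 2 ^ (L + 1)

/-- Data at the root: `s_ρ = 2^(2^L)`, `b(ρ) = B`, `A_d(ρ) = A_s(ρ) = 0`. -/
def start (L : ℕ) : St := ⟨2 ^ 2 ^ L, Bq L, 0, 0⟩

/-- A node of the tree `T` is identified with its root-to-node path
(`true` = right branch); nodes of `T` are exactly the paths of length `< L`. -/
def walk (L : ℕ) (v : List Bool) : St := walkAux L (start L) v

/-- The size `s_v`. -/
def size (L : ℕ) (v : List Bool) : ℚ := (walk L v).sz

/-- The residual budget `b(v)`. -/
def budget (L : ℕ) (v : List Bool) : ℚ := (walk L v).bu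

/-- `A_d(v)`: total edge length on the root-to-`v` path. -/
def Ad (L : ℕ) (v : List Bool) : ℚ := (walk L v).dist

/-- `A_s(v)`: total size of strict ancestors of `v` from which the path to `v`
goes right. -/
def As (L : ℕ) (v : List Bool) : ℚ := (walk L v).inst

/-- The level `ℓ(v)`: the root is at level `L`, the leaves at level `1`. -/
def level (L : ℕ) (v : List Bool) : ℕ := L - v.length

end StocOrient

namespace StocOrient

lemma step_true (n : ℕ) (x : St) : step (n + 1) x true =
    ⟨x.sz * 2 ^ 2 ^ n, x.bu - x.sz, x.dist, x.inst + x.sz⟩ := by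
  have h : (2 : ℚ) ^ ((2 : ℤ) ^ n) = 2 ^ 2 ^ n := by
    rw [← zpow_natCast]; norm_cast
  simp [step, h]

lemma step_false (n : ℕ) (x : St) : step (n + 1) x false =
    ⟨x.sz / 2 ^ 2 ^ n, x.sz, x.dist + (x.bu - x.sz), x.inst⟩ := by
  have h : (2 : ℚ) ^ ((2 : ℤ) ^ n) = 2 ^ 2 ^ n := by
    rw [← zpow_natCast]; norm_cast
  simp [step, zpow_neg, h, div_eq_mul_inv]

lemma walkAux_append (l : ℕ) (x : St) (p q : List Bool) :
    walkAux l x (p ++ q) = walkAux (l - p.length) (walkAux l x p) q := by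
  induction p generalizing l x with
  | nil => simp [walkAux]
  | cons d p ih =>
    simp only [List.cons_append, walkAux, List.length_cons, ih]
    congr 1
    omega

/-- A property of (level, state) pairs preserved by every step within the tree is preserved by
walks. -/
lemma walkAux_induction {P : ℕ → St → Prop}
    (hP : ∀ n x d, 1 ≤ n → P (n + 1) x → P n (step (n + 1) x d))
    {l : ℕ} {x : St} {p : List Bool} (hp : p.length < l) (h : P l x) :
    P (l - p.length) (walkAux l x p) := by
  induction p generalizing l x with
  | nil => simpa [walkAux] using h
  | cons d p ih =>
    obtain ⟨n, rfl⟩ : ∃ n, l = n + 1 := ⟨l - 1, by grind⟩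
    simp only [List.length_cons, Nat.add_lt_add_iff_right] at hp
    simpa [walkAux] using ih hp (hP n x d (by omega) h)

lemma four_le_two_pow_two_pow {n : ℕ} (hn : 1 ≤ n) : (4 : ℚ) ≤ 2 ^ 2 ^ n := by
  have h : 2 ^ 1 ≤ 2 ^ n := Nat.pow_le_pow_right (by norm_num) hn
  calc (4 : ℚ) = 2 ^ 2 ^ 1 := by norm_num
    _ ≤ 2 ^ 2 ^ n := pow_le_pow_right₀ (by norm_num) h

/-- Conservation of the budget together with the size estimates, for a state at level `l`. -/
structure Balanced (B : ℚ) (l : ℕ) (x : St) : Prop where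
  sz_pos : 0 < x.sz
  total : x.dist + x.inst + x.bu = B
  sz_le_bu : 2 * x.sz * 2 ^ 2 ^ l ≤ 2 * x.bu + x.sz
  inst_le : x.inst * 2 ^ 2 ^ l ≤ 2 * x.sz

lemma Balanced.step {B : ℚ} (n : ℕ) (x : St) (d : Bool) (hn : 1 ≤ n)
    (h : Balanced B (n + 1) x) : Balanced B n (step (n + 1) x d) := by
  obtain ⟨h₁, h₂, h₃, h₄⟩ := h
  have hK := four_le_two_pow_two_pow hn
  rw [pow_succ, pow_mul] at h₃ h₄
  cases d
  · rw [step_false]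
    generalize hKn : (2 : ℚ) ^ 2 ^ n = K at *
    have hK₀ : 0 < K := by linarith
    have hs : 0 < x.sz / K := by positivity
    refine ⟨hs, by simp only; linarith, ?_, ?_⟩
    · simp only [hKn]
      rw [mul_assoc, div_mul_cancel₀ _ hK₀.ne']
      linarith
    · simp only [hKn]
      rw [← mul_div_assoc, le_div_iff₀ hK₀]
      linarith
  · rw [step_true]
    generalize hKn : (2 : ℚ) ^ 2 ^ n = K at *
    have hs : 4 * x.sz ≤ x.sz * K := by nlinarith
    refine ⟨by simp only; linarith, by simp only; linarith, by simp only [hKn]; nlinarith, ?_⟩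
    have hi : x.inst ≤ x.sz := by
      by_contra! hlt
      nlinarith [mul_pos h₁ h₁]
    simp only [hKn]
    nlinarith

lemma balanced_start (L : ℕ) : Balanced (Bq L) L (start L) := by
  refine ⟨by simp [start], by simp [start], ?_, by simp [start]⟩
  have h : (0 : ℚ) < 2 ^ 2 ^ L := by positivity
  simp only [start, Bq, pow_succ 2 L, pow_mul]
  nlinarith

lemma Balanced.sz_le {B : ℚ} {l : ℕ} {x : St} (hl : 1 ≤ l) (h : Balanced B l x) :
    x.sz ≤ x.bu := by
  nlinarith [h.sz_pos, h.sz_le_bu, four_le_two_pow_two_pow hl]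

/-- Distances do not decrease along a walk. -/
lemma Balanced.dist_le_walkAux {B : ℚ} {l : ℕ} {x : St} {p : List Bool} (hp : p.length < l)
    (h : Balanced B l x) : x.dist ≤ (walkAux l x p).dist := by
  refine (walkAux_induction (P := fun l y ↦ Balanced B l y ∧ x.dist ≤ y.dist) ?_ hp
    ⟨h, le_rfl⟩).2
  rintro n y d hn ⟨hy, hxy⟩
  refine ⟨hy.step n y d hn, ?_⟩
  have := hy.sz_le (by omega)
  cases d
  · rw [step_false]; simp only; linarith
  · rw [step_true]; exact hxy

/-- The ratio of the size of a node at level `l` to `2 ^ 2 ^ l` does not decrease along a walk. -/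
lemma mul_le_walkAux_sz {c : ℚ} {l : ℕ} {x : St} {p : List Bool} (hp : p.length < l)
    (hc : 0 ≤ c) (h : c * 2 ^ 2 ^ l ≤ x.sz) :
    c * 2 ^ 2 ^ (l - p.length) ≤ (walkAux l x p).sz := by
  refine walkAux_induction (P := fun l y ↦ c * 2 ^ 2 ^ l ≤ y.sz) ?_ hp h
  intro n y d hn hy
  have hK := four_le_two_pow_two_pow hn
  rw [pow_succ, pow_mul] at hy
  cases d
  · rw [step_false]
    generalize (2 : ℚ) ^ 2 ^ n = K at *
    simp only
    rw [le_div_iff₀ (by linarith)]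
    linarith
  · rw [step_true]
    generalize (2 : ℚ) ^ 2 ^ n = K at *
    simp only
    have : c ≤ y.sz := by nlinarith [mul_nonneg hc (by nlinarith : (0 : ℚ) ≤ K ^ 2 - 1)]
    gcongr

end StocOrient

open StocOrient

/-- For an internal node `a`, any node `u` of the right subtree `R_a` and any
node `v` of the left subtree `L_a` satisfy `A_d(v) + s_u > B`: a non-adaptive
policy on the line cannot collect reward from `v` once a blocking vertex `u`
instantiates positively. -/
theorem stmt16 (L : ℕ) (hL : 2 ≤ L) (a u v : List Bool)
    (hu : u.length < L) (hupre : (a ++ [true]) <+: u)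
    (hv : v.length < L) (hvpre : (a ++ [false]) <+: v) :
    Bq L < Ad L v + size L u := by
  obtain ⟨p, rfl⟩ := hupre
  obtain ⟨q, rfl⟩ := hvpre
  simp only [List.append_assoc, List.cons_append, List.nil_append, List.length_append,
    List.length_cons] at hu hv ⊢
  have ha : Balanced (Bq L) (L - a.length) (walkAux L (start L) a) :=
    walkAux_induction Balanced.step (by omega) (balanced_start L)
  simp only [Ad, size, walk, walkAux_append]
  generalize walkAux L (start L) a = x at ha
  obtain ⟨n, hn⟩ : ∃ n, L - a.length = n + 1 := ⟨L - a.length - 1, by omega⟩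
  rw [hn] at ha ⊢
  simp only [walkAux, Nat.add_sub_cancel]
  have hdist := (ha.step n x false (by omega)).dist_le_walkAux (p := q) (by omega)
  have hsz := mul_le_walkAux_sz (c := x.sz) (l := n) (x := step (n + 1) x true) (p := p)
    (by omega) ha.sz_pos.le (by rw [step_true])
  have hd : (step (n + 1) x false).dist = x.dist + (x.bu - x.sz) := by rw [step_false]
  have h₄ := four_le_two_pow_two_pow (n := n - p.length) (by omega)
  have hK := four_le_two_pow_two_pow (n := n + 1) (by omega)
  have hpos := ha.sz_pos
  have htot := ha.total
  have hi : x.inst ≤ x.sz := by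
    by_contra! hlt
    nlinarith [ha.inst_le]
  nlinarith
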